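/- Let M₇ be the Turing machine with states {A,B,C,D,E,F,H} and symbols {0,1} whose transition table is: δ(A,0)=(1,R,B), δ(A,1)=(0,L,B); δ(B,0)=(0,R,C), δ(B,1)=(1,L,B); δ(C,0)=(1,R,D), δ(C,1)=(0,L,A); δ(D,0)=(1,L,E), δ(D,1)=(1,L,F); δ(E,0)=(1,L,A), δ(E,1)=(0,L,D); δ(F,0)=(1,R,H), δ(F,1)=(1,L,E). Then, started on a blank tape, M₇ halts: ^ω0 (A0) 0^ω ⊢(s) ^ω0 1 (H1) (011)^p 0 1 0 1 0^ω, where s = 2048·(4^{1533} − 1)/3 − 11·2^{1538} + 14141831 and p = (2^{1538} − 10)/3. In particular M₇ halts in exactly s steps and its halting configuration carries exactly 2·(2^{1538} − 10)/3 + 4 symbols 1. -/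

import Mathlib

open Turing

inductive TSt where | A | B | C | D | E | F | H
deriving DecidableEq

inductive Gam where | s0 | s1
deriving DecidableEq

instance : Inhabited Gam := ⟨Gam.s0⟩

abbrev Cfg := TSt × Tape Gam

/-- The transition table of the machine (values from the halting state `H` are never used). -/
def delta : TSt → Gam → Gam × Dir × TSt
  | .A, .s0 => (.s1, Dir.right, .B)
  | .A, .s1 => (.s0, Dir.left, .B)
  | .B, .s0 => (.s0, Dir.right, .C)
  | .B, .s1 => (.s1, Dir.left, .B)
  | .C, .s0 => (.s1, Dir.right, .D)
  | .C, .s1 => (.s0, Dir.left, .A)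
  | .D, .s0 => (.s1, Dir.left, .E)
  | .D, .s1 => (.s1, Dir.left, .F)
  | .E, .s0 => (.s1, Dir.left, .A)
  | .E, .s1 => (.s0, Dir.left, .D)
  | .F, .s0 => (.s1, Dir.right, .H)
  | .F, .s1 => (.s1, Dir.left, .E)
  | .H, a => (a, Dir.right, .H)

/-- One computation step; `none` if the current state is the halting state `H`. -/
def step (c : Cfg) : Option Cfg :=
  if c.1 = TSt.H then none
  else
    let t := delta c.1 c.2.head
    some (t.2.2, (c.2.write t.1).move t.2.1)

/-- `reaches t c₁ c₂` : iterating `step` exactly `t` times starting from `c₁` yields `c₂`. -/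
def reaches (t : ℕ) (c₁ c₂ : Cfg) : Prop :=
  (fun c => Option.bind c step)^[t] (some c₁) = some c₂

/-- The configuration `^ω0 x (q a) y 0^ω` : state `q`, head reading `a`, the word `x`
written immediately to the left of the head (in order), `y` immediately to the right,
blank elsewhere. -/
def mkCfg (x : List Gam) (q : TSt) (a : Gam) (y : List Gam) : Cfg :=
  (q, ⟨a, ListBlank.mk x.reverse, ListBlank.mk y⟩)

/-- The configuration with state `q`, scanned symbol `a`, the word `l` to the left of the head
(nearest symbol first) and the word `r` to its right. -/
def conf (q : TSt) (l : List Gam) (a : Gam) (r : List Gam) : Cfg :=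
  (q, ⟨a, ListBlank.mk l, ListBlank.mk r⟩)

theorem reaches.trans {s t : ℕ} {c₁ c₂ c₃ : Cfg} (h₁ : reaches s c₁ c₂)
    (h₂ : reaches t c₂ c₃) : reaches (s + t) c₁ c₃ := by
  unfold reaches at *
  rw [Nat.add_comm, Function.iterate_add_apply, h₁, h₂]

/-- The configuration obtained from `conf q l a r` after the given number of steps, or `none` if
the machine has halted before that. -/
def run : ℕ → TSt → List Gam → Gam → List Gam → Option Cfg
  | 0, q, l, a, r => some (conf q l a r)
  | _ + 1, .H, _, _, _ => none
  | n + 1, q, l, a, r =>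
    match delta q a with
    | (b, .left, q') => run n q' l.tail l.headI (b :: r)
    | (b, .right, q') => run n q' (b :: l) r.headI r.tail

theorem reaches_of_run {n : ℕ} {q : TSt} {l r : List Gam} {a : Gam} {c : Cfg}
    (h : run n q l a r = some c) : reaches n (conf q l a r) c := by
  induction n generalizing q l a r with
  | zero => exact h
  | succ n ih =>
    rw [Nat.add_comm]
    cases q <;> cases a <;> first
      | exact reaches.trans (s := 1) rfl (ih h)
      | simp [run] at h

/-- The word `1^n` followed by `r`. -/
def ones (n : ℕ) (r : List Gam) : List Gam := (Gam.s1 :: ·)^[n] r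

theorem ones_succ (n : ℕ) (r : List Gam) : ones (n + 1) r = .s1 :: ones n r :=
  Function.iterate_succ_apply' _ n r

theorem ones_succ' (n : ℕ) (r : List Gam) : ones (n + 1) r = ones n (.s1 :: r) := rfl

/-- The word `(011)^k` followed by `r`. -/
def blocks : ℕ → List Gam → List Gam
  | 0, r => r
  | k + 1, r => .s0 :: .s1 :: .s1 :: blocks k r

theorem blocks_succ' (k : ℕ) (r : List Gam) :
    blocks (k + 1) r = blocks k (.s0 :: .s1 :: .s1 :: r) := by
  induction k with
  | zero => rfl
  | succ k ih => rw [blocks, ih]; rfl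

theorem blocks_eq_flatten (k : ℕ) (r : List Gam) :
    blocks k r = (List.replicate k [Gam.s0, .s1, .s1]).flatten ++ r := by
  induction k with
  | zero => rfl
  | succ k ih => simp [blocks, ih, List.replicate_succ]

/-- The configuration `^ω0 (A0) 0 1^n r`. -/
def start (n : ℕ) (r : List Gam) : Cfg := conf .A [] .s0 (.s0 :: ones n r)

theorem reaches_sweep_right (n : ℕ) (l r : List Gam) :
    reaches (3 * n) (conf .A l .s0 (.s0 :: ones n r)) (conf .A (ones n l) .s0 (.s0 :: r)) := by
  induction n generalizing l with
  | zero => rfl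
  | succ n ih =>
    have h : reaches 3 (conf .A l .s0 (.s0 :: ones (n + 1) r))
        (conf .A (.s1 :: l) .s0 (.s0 :: ones n r)) := by
      rw [ones_succ]; rfl
    have := h.trans (ih (.s1 :: l))
    rwa [show 3 + 3 * n = 3 * (n + 1) by ring, ← ones_succ'] at this

theorem reaches_sweep_left (n : ℕ) (r : List Gam) :
    reaches (n + 1) (conf .B (ones n []) .s1 r) (conf .B [] .s0 (ones (n + 1) r)) := by
  induction n generalizing r with
  | zero => rfl
  | succ n ih =>
    have h : reaches 1 (conf .B (ones (n + 1) []) .s1 r) (conf .B (ones n []) .s1 (.s1 :: r)) := by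
      rw [ones_succ]; rfl
    have := h.trans (ih (.s1 :: r))
    rwa [show 1 + (n + 1) = n + 1 + 1 by ring, ← ones_succ'] at this

theorem reaches_start_transfer (n : ℕ) (r : List Gam) :
    reaches (4 * n + 13) (start (n + 1) (.s0 :: .s1 :: r))
      (start n (.s0 :: .s1 :: .s1 :: .s1 :: r)) := by
  have h₁ := reaches_sweep_right (n + 1) [] (.s0 :: .s1 :: r)
  have h₂ : reaches 7 (conf .A (ones (n + 1) []) .s0 (.s0 :: .s0 :: .s1 :: r))
      (conf .B (ones n []) .s1 (.s0 :: .s1 :: .s1 :: .s1 :: r)) := by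
    rw [ones_succ]; rfl
  have h₃ := reaches_sweep_left n (.s0 :: .s1 :: .s1 :: .s1 :: r)
  have h₄ : reaches 2 (conf .B [] .s0 (ones (n + 1) (.s0 :: .s1 :: .s1 :: .s1 :: r)))
      (start n (.s0 :: .s1 :: .s1 :: .s1 :: r)) := by
    rw [ones_succ]; rfl
  have := ((h₁.trans h₂).trans h₃).trans h₄
  rwa [show 3 * (n + 1) + 7 + (n + 1) + 2 = 4 * n + 13 by ring] at this

theorem reaches_start_zero (r : List Gam) :
    reaches 17 (start 0 (.s0 :: .s1 :: r)) (start 5 r) := reaches_of_run rfl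

theorem reaches_start_merge (n m : ℕ) (r : List Gam) :
    reaches (2 * n ^ 2 + 11 * n + 17) (start n (.s0 :: ones (m + 1) r))
      (start (2 * n + m + 5) r) := by
  induction n generalizing m with
  | zero =>
    have := reaches_start_zero (ones m r)
    rw [ones_succ]
    rw [show start 5 (ones m r) = start (2 * 0 + m + 5) r by
      rw [start, start, ones, ones, ones, ← Function.iterate_add_apply,
        show 5 + m = 2 * 0 + m + 5 by ring]] at this
    exact this
  | succ n ih =>
    have h₁ := reaches_start_transfer n (ones m r)
    have h₂ := ih (m + 2)
    rw [ones_succ, ones_succ, ones_succ] at h₂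
    have := h₁.trans h₂
    rw [ones_succ]
    rwa [show 4 * n + 13 + (2 * n ^ 2 + 11 * n + 17) = 2 * (n + 1) ^ 2 + 11 * (n + 1) + 17 by ring,
      show 2 * n + (m + 2) + 5 = 2 * (n + 1) + m + 5 by ring] at this

theorem reaches_start_merge_one (n : ℕ) (r : List Gam) :
    reaches (2 * n ^ 2 + 11 * n + 17) (start n (.s0 :: .s1 :: r)) (start (2 * n + 5) r) :=
  reaches_start_merge n 0 r

theorem reaches_start_merge_two (n : ℕ) (r : List Gam) :
    reaches (2 * n ^ 2 + 11 * n + 17) (start n (.s0 :: .s1 :: .s1 :: r)) (start (2 * n + 6) r) :=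
  reaches_start_merge n 1 r

/-- The number of steps needed to absorb `d` blocks `011` into a word `1^n`. -/
def absorbTime : ℕ → ℕ → ℕ
  | _, 0 => 0
  | n, d + 1 => (2 * n ^ 2 + 11 * n + 17) + absorbTime (2 * n + 6) d

theorem absorbTime_spec (n d : ℕ) :
    3 * absorbTime n d + 39 * (n + 6) * 2 ^ d + 2 * (n + 6) ^ 2
      = 2 * (n + 6) ^ 2 * 4 ^ d + 39 * (n + 6) + 69 * d := by
  induction d generalizing n with
  | zero => simp [absorbTime]; ring
  | succ d ih =>
    have := ih (2 * n + 6)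
    simp only [absorbTime, pow_succ]
    zify at this ⊢
    linear_combination this

theorem reaches_start_absorb (n d : ℕ) (r : List Gam) :
    reaches (absorbTime n d) (start n (blocks d r)) (start ((n + 6) * 2 ^ d - 6) r) := by
  induction d generalizing n with
  | zero => rw [pow_zero, mul_one, Nat.add_sub_cancel]; rfl
  | succ d ih =>
    have := (reaches_start_merge_two n (blocks d r)).trans (ih (2 * n + 6))
    rwa [show (2 * n + 6 + 6) * 2 ^ d = (n + 6) * 2 ^ (d + 1) by ring] at this

theorem reaches_turn (n : ℕ) :
    reaches (3 * n + 6) (start n []) (conf .E (ones n []) .s1 [.s1, .s0, .s1]) :=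
  (reaches_sweep_right n [] []).trans (reaches_of_run rfl : reaches 6 (conf .A (ones n []) .s0 [.s0]) _)

theorem reaches_carve_blocks (k : ℕ) (l r : List Gam) :
    reaches (3 * k + 1) (conf .E (ones (3 * k) l) .s1 r)
      (conf .D l.tail l.headI (blocks k (.s0 :: r))) := by
  induction k generalizing r with
  | zero => rfl
  | succ k ih =>
    have h : reaches 3 (conf .E (ones (3 * (k + 1)) l) .s1 r)
        (conf .E (ones (3 * k) l) .s1 (.s1 :: .s1 :: .s0 :: r)) := by
      rw [show 3 * (k + 1) = 3 * k + 1 + 1 + 1 by ring, ones_succ, ones_succ, ones_succ]; rfl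
    have := h.trans (ih (.s1 :: .s1 :: .s0 :: r))
    rwa [show 3 + (3 * k + 1) = 3 * (k + 1) + 1 by ring, ← blocks_succ'] at this

theorem reaches_unpack (k j : ℕ) :
    reaches (12 * k + 3 * j + 7) (start (3 * k + j) [])
      (conf .D (ones j []).tail (ones j []).headI (blocks k [.s0, .s1, .s0, .s1])) := by
  have h₁ := reaches_turn (3 * k + j)
  have h₂ := reaches_carve_blocks k (ones j []) [.s1, .s0, .s1]
  rw [show ones (3 * k) (ones j []) = ones (3 * k + j) [] from
    (Function.iterate_add_apply _ _ _ _).symm] at h₂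
  have := h₁.trans h₂
  rwa [show 3 * (3 * k + j) + 6 + (3 * k + 1) = 12 * k + 3 * j + 7 by ring] at this

theorem reaches_start_mod_zero (k : ℕ) :
    reaches (12 * k + 73) (start (3 * (k + 1)) []) (start 10 (blocks k [.s0, .s1, .s0, .s1])) :=
  (reaches_unpack (k + 1) 0).trans
    (reaches_of_run rfl : reaches 54 (conf .D [] .s0 (blocks (k + 1) [.s0, .s1, .s0, .s1])) _)

theorem reaches_halt_mod_one (k : ℕ) :
    reaches (12 * k + 12) (start (3 * k + 1) [])
      (conf .H [.s1] .s1 (blocks k [.s0, .s1, .s0, .s1])) :=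
  (reaches_unpack k 1).trans
    (reaches_of_run rfl : reaches 2 (conf .D [] .s1 (blocks k [.s0, .s1, .s0, .s1])) _)

theorem reaches_start_mod_two (k : ℕ) :
    reaches (12 * k + 101) (start (3 * (k + 1) + 2) [])
      (start 12 (blocks k [.s0, .s1, .s0, .s1])) :=
  (reaches_unpack (k + 1) 2).trans
    (reaches_of_run rfl : reaches 76 (conf .D [.s1] .s1 (blocks (k + 1) [.s0, .s1, .s0, .s1])) _)

theorem reaches_blank_start :
    reaches 61 (conf .A [] .s0 []) (start 9 [.s0, .s1]) := reaches_of_run rfl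

theorem reaches_start_absorb_all (n d : ℕ) :
    reaches (absorbTime n d + (2 * ((n + 6) * 2 ^ d - 6) ^ 2 + 11 * ((n + 6) * 2 ^ d - 6) + 17)
        + (2 * (2 * ((n + 6) * 2 ^ d - 6) + 5) ^ 2 + 11 * (2 * ((n + 6) * 2 ^ d - 6) + 5) + 17))
      (start n (blocks d [.s0, .s1, .s0, .s1]))
      (start (2 * (2 * ((n + 6) * 2 ^ d - 6) + 5) + 5) []) :=
  ((reaches_start_absorb n d _).trans (reaches_start_merge_one _ _)).trans
    (reaches_start_merge_one _ _)

theorem reaches_start_large : reaches 14087385 (conf .A [] .s0 []) (start (3 * 1533) []) := by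
  have h₁ := reaches_blank_start.trans (reaches_start_merge_one 9 [])
  have h₂ := (h₁.trans (reaches_start_mod_two 6)).trans (reaches_start_absorb_all 12 6)
  have hn : 2 * (2 * ((12 + 6) * 2 ^ 6 - 6) + 5) + 5 = 3 * 1533 := by norm_num
  rw [hn] at h₂
  have ht := absorbTime_spec 12 6
  refine (congrArg (reaches · _ _) ?_).mpr h₂
  norm_num at ht ⊢
  omega

set_option exponentiation.threshold 4000 in
theorem stmt19 :
    reaches (2048*(4^1533 - 1)/3 - 11*2^1538 + 14141831)
      (mkCfg [] .A .s0 [])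
      (mkCfg [.s1] .H .s1
        ((List.replicate ((2^1538 - 10)/3) [Gam.s0, .s1, .s1]).flatten ++
          [.s0, .s1, .s0, .s1])) := by
  have h := (reaches_start_large.trans (reaches_start_mod_zero 1532)).trans
    (reaches_start_absorb_all 10 1532)
  have hn : 2 * (2 * ((10 + 6) * 2 ^ 1532 - 6) + 5) + 5 = 3 * ((2 ^ 1538 - 10) / 3) + 1 := by
    norm_num
  rw [hn] at h
  have h' := h.trans (reaches_halt_mod_one _)
  rw [blocks_eq_flatten] at h'
  have ht := absorbTime_spec 10 1532
  refine (congrArg (reaches · _ _) ?_).mpr h'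
  norm_num at ht ⊢
  omega
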